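/- arXiv:1803.04852 — 3 statements merged into one kernel-verified Lean document; each statement's English description precedes it below -/
import Mathlib

section
/- Let d ≥ 2 and k ≥ 0 be integers. For every simplex S ∈ S^d(k,1), one has vol(S) ≤ (1/d!) · (k+1) · (s_d − 1)^2, and this bound equals vol(S_{d,k}). -/
open MeasureTheory ENNReal

noncomputable section

/-- Auxiliary recursion for the Sylvester sequence: `s_{i+1} = s_i (s_i - 1) + 1`,
which is equivalent to `s_i = 1 + s_1 ⋯ s_{i-1}` with `s_1 = 2`. -/
def sylAux : ℕ → ℕ
  | 0 => 2
  | n + 1 => sylAux n * (sylAux n - 1) + 1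

/-- The Sylvester sequence `s_1 = 2`, `s_i = 1 + s_1 s_2 ⋯ s_{i-1}` (1-indexed). -/
def syl (n : ℕ) : ℕ := sylAux (n - 1)

/-- The standard basis vector `e_i` of `ℝ^d`. -/
def stdBasis (d : ℕ) (i : Fin d) : Fin d → ℝ := Pi.single i 1

/-- The integer lattice `ℤ^d`, viewed as a subset of `ℝ^d`. -/
def latticePts (d : ℕ) : Set (Fin d → ℝ) :=
  Set.range fun z : Fin d → ℤ => fun i => (z i : ℝ)

/-- The Zaks–Perles–Wills simplex
`S_{d,k} = conv(0, s_1 e_1, …, s_{d-1} e_{d-1}, (k+1)(s_d - 1) e_d)`. -/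
def ZPW (d k : ℕ) : Set (Fin d → ℝ) :=
  convexHull ℝ (insert 0 (Set.range fun i : Fin d =>
    (if i.1 = d - 1 then ((k : ℝ) + 1) * ((syl d : ℝ) - 1) else (syl (i.1 + 1) : ℝ)) •
      stdBasis d i))

lemma zp_abel (x l : ℕ → ℝ) (n : ℕ) (hx : ∀ i ≤ n, 0 < x i)
    (hanti : ∀ i < n, x (i + 1) ≤ x i)
    (hL : ∀ j ≤ n, 0 < ∑ i ∈ Finset.range (j + 1), l i) :
    x n * ∑ i ∈ Finset.range (n + 1), l i ≤ ∑ i ∈ Finset.range (n + 1), x i * l i := by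
  induction n with
  | zero => simp
  | succ n ih =>
    have h1 := ih (fun i hi => hx i (by omega)) (fun i hi => hanti i (by omega))
      (fun j hj => hL j (by omega))
    rw [Finset.sum_range_succ (n := n + 1), Finset.sum_range_succ (f := fun i => x i * l i) (n := n + 1)]
    have h2 := mul_le_mul_of_nonneg_right (hanti n (by omega)) (hL n (by omega)).le
    nlinarith

lemma zp_maj (x y : ℕ → ℝ) (n : ℕ) (hx : ∀ i ≤ n, 0 < x i) (hy : ∀ i ≤ n, 0 < y i)
    (hanti : ∀ i < n, x (i + 1) ≤ x i)
    (hP : ∀ j ≤ n, ∏ i ∈ Finset.range (j + 1), x i < ∏ i ∈ Finset.range (j + 1), y i) :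
    ∑ i ∈ Finset.range (n + 1), x i < ∑ i ∈ Finset.range (n + 1), y i := by
  have hL : ∀ j ≤ n, 0 < ∑ i ∈ Finset.range (j + 1), Real.log (y i / x i) := by
    intro j hj
    rw [← Real.log_prod]
    · apply Real.log_pos
      rw [Finset.prod_div_distrib, one_lt_div]
      · exact hP j hj
      · exact Finset.prod_pos fun i hi => hx i (by simp at hi; omega)
    · intro i hi
      have hi' : i ≤ n := by simp at hi; omega
      exact (div_pos (hy i hi') (hx i hi')).ne'
  have h := zp_abel x (fun i => Real.log (y i / x i)) n hx hanti hL
  have h0 : 0 < x n * ∑ i ∈ Finset.range (n + 1), Real.log (y i / x i) :=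
    mul_pos (hx n le_rfl) (hL n le_rfl)
  have h1 : ∑ i ∈ Finset.range (n + 1), x i * Real.log (y i / x i) ≤
      ∑ i ∈ Finset.range (n + 1), (y i - x i) := by
    apply Finset.sum_le_sum
    intro i hi
    have hi' : i ≤ n := by simp at hi; omega
    have hxi := hx i hi'
    have := Real.log_le_sub_one_of_pos (div_pos (hy i hi') hxi)
    calc x i * Real.log (y i / x i) ≤ x i * (y i / x i - 1) :=
          mul_le_mul_of_nonneg_left this hxi.le
      _ = y i - x i := by field_simp
  rw [Finset.sum_sub_distrib] at h1
  linarith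

lemma two_le_sylAux (n : ℕ) : 2 ≤ sylAux n := by
  induction n with
  | zero => simp [sylAux]
  | succ n ih =>
    simp only [sylAux]
    have : 1 ≤ sylAux n - 1 := by omega
    nlinarith

/-- `Q j = 1/(s_{j+1} - 1)` -/
def zpQ (j : ℕ) : ℝ := 1 / ((sylAux j : ℝ) - 1)

lemma zp_cast (n : ℕ) : (2 : ℝ) ≤ sylAux n := by exact_mod_cast two_le_sylAux n

lemma zpQ_pos (j : ℕ) : 0 < zpQ j := by
  have := zp_cast j
  unfold zpQ
  apply one_div_pos.2; linarith

lemma sylAux_succ_real (j : ℕ) : (sylAux (j + 1) : ℝ) - 1 = sylAux j * ((sylAux j : ℝ) - 1) := by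
  have := two_le_sylAux j
  simp only [sylAux]
  push_cast [Nat.cast_sub (show 1 ≤ sylAux j by omega)]
  ring

lemma zpQ_succ (j : ℕ) : zpQ (j + 1) = zpQ j * (1 / (sylAux j : ℝ)) := by
  unfold zpQ
  rw [sylAux_succ_real]
  have := zp_cast j
  have h1 : (sylAux j : ℝ) ≠ 0 := by linarith
  have h2 : (sylAux j : ℝ) - 1 ≠ 0 := by intro h; linarith
  field_simp

lemma zpQ_diff (j : ℕ) : zpQ j - zpQ (j + 1) = 1 / (sylAux j : ℝ) := by
  unfold zpQ
  rw [sylAux_succ_real]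
  have := zp_cast j
  have h1 : (sylAux j : ℝ) ≠ 0 := by linarith
  have h2 : (sylAux j : ℝ) - 1 ≠ 0 := by intro h; linarith
  field_simp

/-- extremal sequence for `d = D+1` -/
def zpY (D i : ℕ) : ℝ := if i < D then 1 / (sylAux i : ℝ) else zpQ D

/-- partial products of the extremal sequence -/
def zpQQ (D j : ℕ) : ℝ := if j ≤ D then zpQ j else zpQ D ^ 2

lemma zpY_pos (D i : ℕ) : 0 < zpY D i := by
  unfold zpY
  split_ifs
  · have := zp_cast i
    apply one_div_pos.2; linarith
  · exact zpQ_pos D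

lemma zpQQ_pos (D i : ℕ) : 0 < zpQQ D i := by
  unfold zpQQ
  split_ifs
  · exact zpQ_pos i
  · exact pow_pos (zpQ_pos D) 2

lemma zpQQ_succ (D j : ℕ) (hj : j ≤ D) : zpQQ D (j + 1) = zpQQ D j * zpY D j := by
  unfold zpQQ zpY
  rcases hj.lt_or_eq with h | rfl
  · simp [h, h.le, Nat.succ_le_of_lt h, zpQ_succ]
  · simp [pow_two]

lemma zpY_tail (D r m : ℕ) (h : r + m = D) :
    ∑ i ∈ Finset.range (m + 1), zpY D (r + i) = zpQ r := by
  induction m generalizing r with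
  | zero => simp at h; subst h; simp [zpY]
  | succ m ih =>
    rw [Finset.sum_range_succ']
    have := ih (r + 1) (by omega)
    simp only [Nat.add_assoc, Nat.add_comm 1] at this
    rw [this]
    have hr : r < D := by omega
    simp only [zpY, Nat.add_zero, if_pos hr, ← zpQ_diff]
    ring

lemma zpQQ_prod (D r m : ℕ) (h : r + m ≤ D + 1) :
    zpQQ D (r + m) = zpQQ D r * ∏ i ∈ Finset.range m, zpY D (r + i) := by
  induction m with
  | zero => simp
  | succ m ih =>
    rw [Finset.prod_range_succ, ← mul_assoc, ← ih (by omega), ← zpQQ_succ _ _ (by omega)]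
    rfl

lemma zp_numeric (D : ℕ) (x : ℕ → ℝ) (hx : ∀ i ≤ D, 0 < x i)
    (hanti : ∀ i < D, x (i + 1) ≤ x i)
    (hsum : ∑ i ∈ Finset.range (D + 1), x i = 1)
    (hps : ∀ j ≤ D, ∏ i ∈ Finset.range j, x i ≤ 1 - ∑ i ∈ Finset.range j, x i) :
    zpQ D ^ 2 ≤ ∏ i ∈ Finset.range (D + 1), x i := by
  classical
  by_contra hcon
  push Not at hcon
  set P : ℕ → ℝ := fun j => ∏ i ∈ Finset.range j, x i with hPdef
  have hPpos : ∀ j ≤ D + 1, 0 < P j := fun j hj =>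
    Finset.prod_pos fun i hi => hx i (by simp at hi; omega)
  -- last index with P r ≥ QQ r
  have hex : ∃ r, r ≤ D ∧ zpQQ D r ≤ P r ∧ ∀ j, r < j → j ≤ D + 1 → P j < zpQQ D j := by
    have h0 : zpQQ D 0 ≤ P 0 := by simp [zpQQ, zpQ, hPdef, sylAux]; norm_num
    let p : ℕ → Prop := fun r => zpQQ D r ≤ P r
    have hspec := Nat.findGreatest_spec (P := p) (n := D) (Nat.zero_le _) h0
    refine ⟨Nat.findGreatest p D, Nat.findGreatest_le _, hspec, ?_⟩
    intro j hj hj2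
    rcases Nat.lt_or_ge D j with h | h
    · have : j = D + 1 := by omega
      subst this
      simpa [zpQQ, hPdef] using hcon
    · have := Nat.findGreatest_is_greatest hj h
      simpa [p] using this
  obtain ⟨r, hrD, hr, hgt⟩ := hex
  obtain ⟨m, hm⟩ := Nat.exists_eq_add_of_le hrD
  have hsplit : ∀ j, P (r + j) = P r * ∏ i ∈ Finset.range j, x (r + i) := fun j =>
    Finset.prod_range_add _ _ _
  have hlt := zp_maj (fun i => x (r + i)) (fun i => zpY D (r + i)) m
    (fun i hi => hx _ (by omega)) (fun i _ => zpY_pos _ _)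
    (fun i hi => hanti (r + i) (by omega)) (by
      intro j hj
      have h1 := hgt (r + (j + 1)) (by omega) (by omega)
      rw [hsplit, zpQQ_prod D r (j + 1) (by omega)] at h1
      have hYp : 0 < ∏ i ∈ Finset.range (j + 1), zpY D (r + i) :=
        Finset.prod_pos fun i _ => zpY_pos _ _
      have h2 : zpQQ D r * ∏ i ∈ Finset.range (j + 1), zpY D (r + i) ≤
          P r * ∏ i ∈ Finset.range (j + 1), zpY D (r + i) :=
        mul_le_mul_of_nonneg_right hr hYp.le
      exact lt_of_mul_lt_mul_left (h1.trans_le h2) (hPpos r (by omega)).le)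
  rw [zpY_tail D r m hm.symm] at hlt
  have h3 : ∑ i ∈ Finset.range (D + 1), x i =
      ∑ i ∈ Finset.range r, x i + ∑ i ∈ Finset.range (m + 1), x (r + i) := by
    rw [hm, Nat.add_assoc, Finset.sum_range_add]
  have h4 := hps r hrD
  have h5 : zpQ r ≤ P r := by simpa [zpQQ, hrD] using hr
  have h6 : P r = ∏ i ∈ Finset.range r, x i := rfl
  linarith

lemma zp_numeric_fin (D : ℕ) (c : Fin (D + 1) → ℝ) (hc : ∀ i, 0 < c i) (hsum : ∑ i, c i = 1)
    (hps : ∀ J : Finset (Fin (D + 1)), J ≠ Finset.univ → ∏ i ∈ J, c i ≤ 1 - ∑ i ∈ J, c i) :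
    zpQ D ^ 2 ≤ ∏ i, c i := by
  set σ := Tuple.sort (fun i => - c i) with hσ
  have hmono : Monotone ((fun i => - c i) ∘ σ) := Tuple.monotone_sort _
  let x : ℕ → ℝ := fun i => if h : i < D + 1 then c (σ ⟨i, h⟩) else 0
  have hxf : ∀ i : Fin (D + 1), x i = c (σ i) := fun i => dif_pos i.2
  have hJ : ∀ j ≤ D + 1, ∃ J : Finset (Fin (D + 1)), J.card = j ∧
      ∏ i ∈ Finset.range j, x i = ∏ i ∈ J, c i ∧ ∑ i ∈ Finset.range j, x i = ∑ i ∈ J, c i := by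
    intro j hj
    refine ⟨Finset.univ.map ((Fin.castLEEmb hj).trans σ.toEmbedding), by simp, ?_, ?_⟩
    · rw [Finset.prod_range, Finset.prod_map]
      exact Finset.prod_congr rfl fun i _ => hxf (Fin.castLE hj i)
    · rw [Finset.sum_range, Finset.sum_map]
      exact Finset.sum_congr rfl fun i _ => hxf (Fin.castLE hj i)
  have hfull : ∀ J : Finset (Fin (D + 1)), J.card = D + 1 → J = Finset.univ := fun J h =>
    Finset.eq_univ_of_card J (by simpa using h)
  obtain ⟨J, hJc, hJp, hJs⟩ := hJ (D + 1) le_rfl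
  rw [hfull J hJc] at hJp hJs
  rw [← hJp]
  apply zp_numeric D x
  · intro i hi
    rw [show x i = c (σ ⟨i, by omega⟩) from hxf ⟨i, by omega⟩]
    exact hc _
  · intro i hi
    rw [show x i = c (σ ⟨i, by omega⟩) from hxf ⟨i, by omega⟩,
      show x (i + 1) = c (σ ⟨i + 1, by omega⟩) from hxf ⟨i + 1, by omega⟩]
    have := hmono (show (⟨i, by omega⟩ : Fin (D + 1)) ≤ ⟨i + 1, by omega⟩ by simp)
    simpa using this
  · rw [hJs, hsum]
  · intro j hj
    obtain ⟨J, hJc, hJp, hJs⟩ := hJ j (by omega)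
    rw [hJp, hJs]
    apply hps
    rintro rfl
    simp at hJc; omega

lemma zp_blich0 {ι : Type} [Fintype ι] (T : Set (ι → ℝ)) (hT : MeasurableSet T) (m : ℕ)
    (h : (m : ℝ≥0∞) < volume T) :
    ∃ x : ι → ℝ, ∃ Z : Finset (ι → ℤ), Z.card = m + 1 ∧
      ∀ z ∈ Z, (x + fun i => (z i : ℝ)) ∈ T := by
  classical
  by_contra hcon
  push Not at hcon
  apply absurd h
  rw [not_lt]
  set F : Set (ι → ℝ) := Set.univ.pi fun _ => Set.Ico 0 1 with hF
  have hFm : MeasurableSet F := MeasurableSet.univ_pi fun _ => measurableSet_Ico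
  have hFv : volume F = 1 := by simp [hF, volume_pi_pi]
  let c : (ι → ℤ) → (ι → ℝ) := fun z i => (z i : ℝ)
  have hTm : ∀ z : ι → ℤ, MeasurableSet ((fun x => x + c z) ⁻¹' T) := fun z =>
    (measurable_add_const (c z)) hT
  have h1 : volume T ≤ ∑' z : ι → ℤ, volume ((fun x => x + c z) ⁻¹' T ∩ F) := by
    have hcov : T ⊆ ⋃ z : ι → ℤ, T ∩ (fun x => x + - c z) ⁻¹' F := by
      intro x hx
      refine Set.mem_iUnion.2 ⟨fun i => ⌊x i⌋, hx, ?_⟩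
      intro i _
      simp only [c, Pi.add_apply, Pi.neg_apply, Set.mem_Ico]
      constructor
      · have := Int.floor_le (x i); linarith
      · have := Int.lt_floor_add_one (x i); linarith
    refine (measure_mono hcov).trans ((measure_iUnion_le _).trans ?_)
    refine ENNReal.tsum_le_tsum fun z => ?_
    rw [← measure_preimage_add_right volume (c z) (T ∩ _)]
    refine measure_mono ?_
    rintro x ⟨hx1, hx2⟩
    refine ⟨hx1, ?_⟩
    simpa using hx2
  refine h1.trans ?_
  have h2 : ∀ z : ι → ℤ, volume ((fun x => x + c z) ⁻¹' T ∩ F) =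
      ∫⁻ x in F, ((fun x => x + c z) ⁻¹' T).indicator 1 x := by
    intro z
    rw [lintegral_indicator_one (hTm z), Measure.restrict_apply (hTm z)]
  simp_rw [h2]
  rw [← lintegral_tsum (fun z => (measurable_one.indicator (hTm z)).aemeasurable)]
  calc ∫⁻ x in F, ∑' z : ι → ℤ, ((fun x => x + c z) ⁻¹' T).indicator 1 x
      ≤ ∫⁻ x in F, (m : ℝ≥0∞) := by
        apply lintegral_mono
        intro x
        simp only
        rw [ENNReal.tsum_eq_iSup_sum]
        refine iSup_le fun Z => ?_
        have h3 : ∑ z ∈ Z, ((fun x => x + c z) ⁻¹' T).indicator (1 : (ι → ℝ) → ℝ≥0∞) x =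
            ((Z.filter fun z => x + c z ∈ T).card : ℝ≥0∞) := by
          rw [Finset.card_filter]
          push_cast
          refine Finset.sum_congr rfl fun z _ => ?_
          simp [Set.indicator_apply]
        rw [h3]
        norm_cast
        by_contra h4
        push Not at h4
        obtain ⟨Z', hZ', hZc⟩ := Finset.exists_subset_card_eq (Nat.succ_le_of_lt h4)
        obtain ⟨z, hz, hz2⟩ := hcon x Z' hZc
        exact hz2 (Finset.mem_filter.1 (hZ' hz)).2
    _ = m := by simp [hFv]

lemma zp_blich {ι : Type} [Fintype ι] [DecidableEq ι] (A : Matrix ι ι ℝ) (hA : A.det ≠ 0)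
    (b : ι → ℝ) (hb : ∀ i, 0 < b i) (m : ℕ) (h : m * |A.det| < ∏ i, b i) :
    ∃ Z : Finset (ι → ℤ), Z.card = m + 1 ∧ ∀ z ∈ Z, ∀ w ∈ Z, ∀ i,
      |A.mulVec (fun j => ((z j - w j : ℤ) : ℝ)) i| < b i := by
  set B : Set (ι → ℝ) := Set.univ.pi fun i => Set.Ico 0 (b i) with hB
  have hBm : MeasurableSet B := MeasurableSet.univ_pi fun _ => measurableSet_Ico
  have hBv : volume B = ENNReal.ofReal (∏ i, b i) := by
    rw [hB, volume_pi_pi, ENNReal.ofReal_prod_of_nonneg fun i _ => (hb i).le]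
    simp
  have hdet : LinearMap.det (Matrix.toLin' A) = A.det := LinearMap.det_toLin' A
  have hcont : Continuous (Matrix.toLin' A) := LinearMap.continuous_of_finiteDimensional _
  have hTv : volume (Matrix.toLin' A ⁻¹' B) = ENNReal.ofReal (|A.det|⁻¹ * ∏ i, b i) := by
    rw [Measure.addHaar_preimage_linearMap _ (by rwa [hdet]), hdet, hBv, abs_inv,
      ← ENNReal.ofReal_mul (by positivity)]
  obtain ⟨x, Z, hZc, hZ⟩ := zp_blich0 (Matrix.toLin' A ⁻¹' B) (hcont.measurable hBm) m (by
    rw [hTv, ← ENNReal.ofReal_natCast]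
    apply (ENNReal.ofReal_lt_ofReal_iff_of_nonneg (by positivity)).2
    have : 0 < |A.det| := abs_pos.2 hA
    rw [inv_mul_eq_div, lt_div_iff₀ this]
    exact h)
  refine ⟨Z, hZc, fun z hz w hw i => ?_⟩
  have h1 := hZ z hz i (Set.mem_univ _)
  have h2 := hZ w hw i (Set.mem_univ _)
  have h3 : A.mulVec (fun j => ((z j - w j : ℤ) : ℝ)) =
      A.mulVec (x + fun i => (z i : ℝ)) - A.mulVec (x + fun i => (w i : ℝ)) := by
    rw [← Matrix.mulVec_sub]
    congr 1
    ext j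
    simp
  rw [h3]
  simp only [Matrix.toLin'_apply, Set.mem_Ico] at h1 h2
  rw [Pi.sub_apply, abs_lt]
  constructor <;> linarith [h1.1, h1.2, h2.1, h2.2]

def zpDelta (n : ℕ) (t : ℝ) : Set (Fin n → ℝ) := {x | (∀ i, 0 ≤ x i) ∧ ∑ i, x i ≤ t}

lemma zpDelta_closed (n : ℕ) (t : ℝ) : IsClosed (zpDelta n t) := by
  have h1 : IsClosed {x : Fin n → ℝ | ∀ i, 0 ≤ x i} := by
    simp only [Set.ofPred_forall]
    exact isClosed_iInter fun i => isClosed_le continuous_const (continuous_apply i)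
  exact h1.inter (isClosed_le (continuous_finsetSum _ fun i _ => continuous_apply i)
    continuous_const)

lemma zpDelta_vol (n : ℕ) (t : ℝ) (ht : 0 ≤ t) :
    volume (zpDelta n t) = ENNReal.ofReal (t ^ n / n.factorial) := by
  induction n generalizing t with
  | zero =>
    have : zpDelta 0 t = Set.univ := by ext x; simp [zpDelta, ht]
    rw [this]
    simp [Measure.volume_pi_eq_dirac (x := (fun _ => (0 : ℝ)))]
  | succ n ih =>
    have hmp := (volume_preserving_piFinSuccAbove (fun _ : Fin (n + 1) => ℝ) 0).symm
    rw [← hmp.measure_preimage (zpDelta_closed _ _).measurableSet.nullMeasurableSet]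
    rw [Measure.volume_eq_prod, Measure.prod_apply
      (hmp.measurable (zpDelta_closed _ _).measurableSet)]
    have hslice : ∀ s : ℝ, volume (Prod.mk s ⁻¹'
        ((MeasurableEquiv.piFinSuccAbove (fun _ : Fin (n + 1) => ℝ) 0).symm ⁻¹' zpDelta (n + 1) t)) =
        (Set.Icc 0 t).indicator (fun s => ENNReal.ofReal ((t - s) ^ n / n.factorial)) s := by
      intro s
      have hmem : ∀ y : Fin n → ℝ, y ∈ (Prod.mk s ⁻¹'
        ((MeasurableEquiv.piFinSuccAbove (fun _ : Fin (n + 1) => ℝ) 0).symm ⁻¹' zpDelta (n + 1) t))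
          ↔ 0 ≤ s ∧ y ∈ zpDelta n (t - s) := by
        intro y
        simp only [Set.mem_preimage, zpDelta, Set.mem_ofPred_eq, Fin.forall_fin_succ,
          Fin.sum_univ_succ, MeasurableEquiv.piFinSuccAbove_symm_apply, Fin.insertNthEquiv_zero,
          Fin.consEquiv_apply, Fin.cons_zero, Fin.cons_succ]
        constructor
        · rintro ⟨⟨h1, h2⟩, h3⟩; exact ⟨h1, h2, by linarith⟩
        · rintro ⟨h1, h2, h3⟩; exact ⟨⟨h1, h2⟩, by linarith⟩
      by_cases hs : s ∈ Set.Icc 0 t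
      · rw [Set.indicator_of_mem hs, ← ih (t - s) (by linarith [hs.2])]
        congr 1
        ext y
        rw [hmem]
        exact and_iff_right hs.1
      · rw [Set.indicator_of_notMem hs]
        convert measure_empty (μ := volume)
        ext y
        rw [hmem]
        simp only [Set.mem_empty_iff_false, iff_false, not_and]
        intro h0 hy
        apply hs
        have := Finset.sum_nonneg fun i (_ : i ∈ Finset.univ) => hy.1 i
        exact ⟨h0, by linarith [hy.2]⟩
    simp_rw [hslice]
    rw [lintegral_indicator measurableSet_Icc, ← ofReal_integral_eq_lintegral_ofReal]
    · congr 1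
      rw [integral_Icc_eq_integral_Ioc, ← intervalIntegral.integral_of_le ht,
        intervalIntegral.integral_div, intervalIntegral.integral_comp_sub_left (fun x => x ^ n) t]
      simp [integral_pow, Nat.factorial_succ]
      field_simp
    · exact ((by fun_prop : Continuous fun s : ℝ => (t - s) ^ n / (n.factorial : ℝ)).continuousOn).integrableOn_Icc
    · refine (ae_restrict_mem measurableSet_Icc).mono fun s hs => ?_
      have : 0 ≤ t - s := by linarith [hs.2]
      simp only [Pi.zero_apply]
      positivity

lemma zp_prodsum_aux (d : ℕ) (w : Fin d → Fin d → ℤ) (p : Fin d → ℤ) (c : Fin d → ℝ)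
    (hc : ∀ i, 0 < c i) (hsum : ∑ i, c i = 1) (hp : ∀ r, (p r : ℝ) = ∑ j, c j * w j r)
    (huniq : ∀ (q : Fin d → ℤ) (a : Fin d → ℝ), (∀ j, 0 < a j) → ∑ j, a j = 1 →
      (∀ r, (q r : ℝ) = ∑ j, a j * w j r) → a = c)
    (J : Finset (Fin d)) (hJ : J ≠ Finset.univ) (n : J → ℤ) (hm : 0 < ∑ i, n i)
    (hn : ∀ i : J, |((∑ i, n i : ℤ) : ℝ) * c i - n i| < c i) : False := by
  classical
  obtain ⟨l, hl⟩ : ∃ l, l ∉ J := by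
    by_contra h; push Not at h; exact hJ (Finset.eq_univ_of_forall h)
  set m := ∑ i, n i with hmdef
  let n' : Fin d → ℤ := fun j => if h : j ∈ J then n ⟨j, h⟩ else 0
  have hn' : ∑ j, n' j = m := by
    rw [hmdef, Finset.univ_eq_attach, ← Finset.sum_subset (Finset.subset_univ J),
      ← Finset.sum_attach]
    · refine Finset.sum_congr rfl fun i _ => ?_
      simp [n']
    · intro x _ hx; simp [n', hx]
  have hm' : (0 : ℝ) < m := by exact_mod_cast hm
  have key := huniq (fun r => (m + 1) * p r - ∑ j, n' j * w j r)
    (fun j => ((m : ℝ) + 1) * c j - n' j) ?_ ?_ ?_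
  · have := congrFun key l
    simp only [n', dif_neg hl] at this
    have h1 := hc l
    push_cast at this
    nlinarith
  · intro j
    by_cases h : j ∈ J
    · have := (abs_lt.1 (hn ⟨j, h⟩)).1
      simp only [n', dif_pos h]
      simp only at this
      linarith
    · simp only [n', dif_neg h]
      have h1 := hc j
      push_cast
      rw [sub_zero]; positivity
  · rw [Finset.sum_sub_distrib, ← Finset.mul_sum, hsum]
    have : (∑ j, (n' j : ℝ)) = m := by exact_mod_cast hn'
    rw [this]; ring
  · intro r
    push_cast
    rw [hp r, Finset.mul_sum, ← Finset.sum_sub_distrib]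
    refine Finset.sum_congr rfl fun j _ => ?_
    ring

lemma zp_prodsum (d : ℕ) (w : Fin d → Fin d → ℤ) (p : Fin d → ℤ) (c : Fin d → ℝ)
    (hc : ∀ i, 0 < c i) (hsum : ∑ i, c i = 1) (hp : ∀ r, (p r : ℝ) = ∑ j, c j * w j r)
    (huniq : ∀ (q : Fin d → ℤ) (a : Fin d → ℝ), (∀ j, 0 < a j) → ∑ j, a j = 1 →
      (∀ r, (q r : ℝ) = ∑ j, a j * w j r) → a = c)
    (J : Finset (Fin d)) (hJ : J ≠ Finset.univ) : ∏ i ∈ J, c i ≤ 1 - ∑ i ∈ J, c i := by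
  classical
  by_contra hcon
  push Not at hcon
  obtain ⟨l, hl⟩ : ∃ l, l ∉ J := by
    by_contra h; push Not at h; exact hJ (Finset.eq_univ_of_forall h)
  have hc1 : ∀ i, c i ≤ 1 := fun i => by
    rw [← hsum]; exact Finset.single_le_sum (fun j _ => (hc j).le) (Finset.mem_univ i)
  have heps : 0 < 1 - ∑ i ∈ J, c i := by
    have : ∑ i ∈ J, c i < ∑ i, c i :=
      Finset.sum_lt_sum_of_subset (Finset.subset_univ J) (Finset.mem_univ l) hl (hc l)
        (fun j _ _ => (hc j).le)
    linarith
  let c' : J → ℝ := fun i => c i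
  let A : Matrix J J ℝ := -(1 + Matrix.replicateCol Unit (-c') * Matrix.replicateRow Unit (1 : J → ℝ))
  have hdet : |A.det| = 1 - ∑ i ∈ J, c i := by
    have h1 : (1 + Matrix.replicateCol Unit (-c') * Matrix.replicateRow Unit (1 : J → ℝ)).det =
        1 - ∑ i ∈ J, c i := by
      rw [Matrix.det_one_add_replicateCol_mul_replicateRow]
      simp only [one_dotProduct, Pi.neg_apply, Finset.sum_neg_distrib, c']
      rw [Finset.sum_coe_sort J c]; ring
    rw [Matrix.det_neg, h1, abs_mul, abs_pow, abs_neg, abs_one, one_pow, one_mul, abs_of_pos heps]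
  have hAv : ∀ (n : J → ℤ) (i : J), A.mulVec (fun j => (n j : ℝ)) i =
      ((∑ i, n i : ℤ) : ℝ) * c i - n i := by
    intro n i
    simp only [A, Matrix.neg_mulVec, Matrix.add_mulVec, Matrix.one_mulVec, Pi.neg_apply,
      Pi.add_apply]
    have : (Matrix.replicateCol Unit (-c') * Matrix.replicateRow Unit (1 : J → ℝ)).mulVec
        (fun j => (n j : ℝ)) i = - (c i * ∑ j, (n j : ℝ)) := by
      simp [Matrix.mulVec, dotProduct, Matrix.mul_apply, c', Finset.mul_sum]
    rw [this]; push_cast; ring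
  obtain ⟨Z, hZc, hZ⟩ := zp_blich A (by intro h; rw [h] at hdet; simp at hdet; linarith) c'
    (fun i => hc i) 1 (by
      rw [hdet, Nat.cast_one, one_mul]
      refine hcon.trans_le (le_of_eq ?_)
      exact (Finset.prod_coe_sort J c).symm)
  obtain ⟨z, z', hzz, rfl⟩ := Finset.card_eq_two.1 hZc
  have hA1 := hZ z (by simp) z' (by simp)
  have hA2 := hZ z' (by simp) z (by simp)
  have e1 : ∀ i, _ := fun i => hAv (fun j => z j - z' j) i
  have e2 : ∀ i, _ := fun i => hAv (fun j => z' j - z j) i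
  simp only [e1] at hA1
  simp only [e2] at hA2
  rcases lt_trichotomy (∑ i, (z i - z' i)) 0 with h | h | h
  · refine zp_prodsum_aux d w p c hc hsum hp huniq J hJ (fun j => z' j - z j) ?_ hA2
    have : ∑ i, (z' i - z i) = - ∑ i, (z i - z' i) := by
      rw [← Finset.sum_neg_distrib]; exact Finset.sum_congr rfl fun i _ => by ring
    rw [this]; linarith
  · apply hzz
    ext i
    have h1 := hA1 i
    rw [h] at h1
    have h2 := h1.trans_le (hc1 i)
    have h3 : |z i - z' i| < 1 := by
      rw [Int.cast_zero, zero_mul, zero_sub, abs_neg] at h2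
      exact_mod_cast h2
    have := Int.abs_lt_one_iff.1 h3
    omega
  · exact zp_prodsum_aux d w p c hc hsum hp huniq J hJ (fun j => z j - z' j) h hA1

def zpM (d : ℕ) (u : Fin d → ℝ) (w : Fin d → Fin d → ℝ) : Matrix (Fin d) (Fin d) ℝ :=
  Matrix.of fun r j => w j r - u r

lemma zpM_mulVec (d : ℕ) (u : Fin d → ℝ) (w : Fin d → Fin d → ℝ) (a : Fin d → ℝ) (r : Fin d) :
    (zpM d u w).mulVec a r = ∑ j, a j * w j r - (∑ j, a j) * u r := by
  simp only [zpM, Matrix.mulVec, dotProduct, Matrix.of_apply, Finset.sum_mul]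
  rw [← Finset.sum_sub_distrib]
  exact Finset.sum_congr rfl fun j _ => by ring

lemma zp_detbound (d k : ℕ) (u : Fin d → ℤ) (w : Fin d → Fin d → ℤ) (p : Fin d → ℤ)
    (c : Fin d → ℝ)
    (hdet : (zpM d (fun r => (u r : ℝ)) (fun j r => (w j r : ℝ))).det ≠ 0)
    (hc : ∀ i, 0 < c i) (hsum : ∑ i, c i = 1) (hp : ∀ r, (p r : ℝ) = ∑ j, c j * w j r)
    (huniq : ∀ (q : Fin d → ℤ) (a : Fin d → ℝ), (∀ j, 0 < a j) → ∑ j, a j = 1 →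
      (∀ r, (q r : ℝ) = ∑ j, a j * w j r) → a = c)
    (hint : ∀ Z : Finset (Fin d → ℤ), (∀ z ∈ Z, ∃ a : Fin d → ℝ, (∀ j, 0 < a j) ∧ ∑ j, a j < 1 ∧
      ∀ r, (z r : ℝ) = u r + (zpM d (fun r => (u r : ℝ)) (fun j r => (w j r : ℝ))).mulVec a r) →
      Z.card ≤ k) :
    |(zpM d (fun r => (u r : ℝ)) (fun j r => (w j r : ℝ))).det| * ∏ i, c i ≤ k + 1 := by
  classical
  set M := zpM d (fun r => (u r : ℝ)) (fun j r => (w j r : ℝ)) with hM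
  by_contra hcon
  push Not at hcon
  have hunit : IsUnit M.det := isUnit_iff_ne_zero.2 hdet
  have hpos : 0 < |M.det| := abs_pos.2 hdet
  have hAdet : (M⁻¹).det = (M.det)⁻¹ := by
    rw [Matrix.det_nonsing_inv, Ring.inverse_eq_inv']
  obtain ⟨Z, hZc, hZ⟩ := zp_blich M⁻¹ (by rw [hAdet]; exact inv_ne_zero hdet) c hc (k + 1) (by
    rw [hAdet, abs_inv, ← div_eq_mul_inv, div_lt_iff₀ hpos]
    push_cast; linarith)
  let g : (Fin d → ℤ) → ℝ := fun z => ∑ i, M⁻¹.mulVec (fun j => (z j : ℝ)) i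
  obtain ⟨z0, hz0, hmax⟩ := Z.exists_max_image g (Finset.card_pos.1 (by omega))
  have hcard := hint ((Z.erase z0).image fun z r => p r + (z r - z0 r)) ?_
  · rw [Finset.card_image_of_injective, Finset.card_erase_of_mem hz0, hZc] at hcard
    · omega
    · intro z z' h
      ext r
      have := congrFun h r
      simp only at this
      omega
  · intro q hq
    obtain ⟨z, hz, rfl⟩ := Finset.mem_image.1 hq
    obtain ⟨hne, hzZ⟩ := Finset.mem_erase.1 hz
    set δ : Fin d → ℝ := fun j => ((z j - z0 j : ℤ) : ℝ) with hδ
    have hMA : M.mulVec (M⁻¹.mulVec δ) = δ := by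
      rw [Matrix.mulVec_mulVec, Matrix.mul_nonsing_inv _ hunit, Matrix.one_mulVec]
    have hlt := hZ z hzZ z0 hz0
    have hsumδ : ∑ i, M⁻¹.mulVec δ i = g z - g z0 := by
      simp only [g]
      rw [← Finset.sum_sub_distrib]
      refine Finset.sum_congr rfl fun i _ => ?_
      rw [← Pi.sub_apply, ← Matrix.mulVec_sub]
      congr 2
      ext j
      simp [hδ]
    have hapos : ∀ j, 0 < c j + M⁻¹.mulVec δ j := fun j => by
      have := (abs_lt.1 (hlt j)).1
      linarith
    have hle := hmax z hzZ
    have hasum : ∑ j, (c j + M⁻¹.mulVec δ j) = 1 + (g z - g z0) := by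
      rw [Finset.sum_add_distrib, hsum, hsumδ]
    have hrep : ∀ r, (p r : ℝ) + δ r = u r + M.mulVec (fun j => c j + M⁻¹.mulVec δ j) r := by
      intro r
      have h1 : M.mulVec (fun j => c j + M⁻¹.mulVec δ j) = M.mulVec c + M.mulVec (M⁻¹.mulVec δ) := by
        rw [← Matrix.mulVec_add]; rfl
      rw [h1, hMA, Pi.add_apply, hM, zpM_mulVec, hsum, hp r]
      ring
    refine ⟨fun j => c j + M⁻¹.mulVec δ j, hapos, ?_, ?_⟩
    · rw [hasum]
      rcases hle.lt_or_eq with h | h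
      · linarith
      · exfalso
        have := huniq (fun r => p r + (z r - z0 r)) (fun j => c j + M⁻¹.mulVec δ j) hapos
          (by rw [hasum, h]; ring) (by
            intro r
            have h2 := hrep r
            rw [hM, zpM_mulVec, hasum, h] at h2
            simp only [hδ] at h2 ⊢
            push_cast at h2 ⊢
            rw [h2]; ring)
        have h0 : M⁻¹.mulVec δ = 0 := by
          ext j
          have := congrFun this j
          simp only [Pi.zero_apply]
          linarith
        rw [h0, Matrix.mulVec_zero] at hMA
        apply hne
        ext r
        have h3 := congrFun hMA r
        simp only [hδ, Pi.zero_apply] at h3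
        have h4 : z r - z0 r = 0 := by exact_mod_cast h3.symm
        omega
    · intro r
      rw [← hrep r]
      simp [hδ]

lemma zpDelta_convex (n : ℕ) (t : ℝ) : Convex ℝ (zpDelta n t) := by
  intro x hx y hy a b ha hb hab
  refine ⟨fun i => ?_, ?_⟩
  · have h1 := hx.1 i
    have h2 := hy.1 i
    simp only [Pi.add_apply, Pi.smul_apply, smul_eq_mul]
    positivity
  · simp only [Pi.add_apply, Pi.smul_apply, smul_eq_mul, Finset.sum_add_distrib, ← Finset.mul_sum]
    calc a * ∑ i, x i + b * ∑ i, y i ≤ a * t + b * t :=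
          add_le_add (mul_le_mul_of_nonneg_left hx.2 ha) (mul_le_mul_of_nonneg_left hy.2 hb)
      _ = t := by rw [← add_mul, hab, one_mul]

lemma zp_hull (d : ℕ) (u : Fin d → ℝ) (w : Fin d → Fin d → ℝ) :
    convexHull ℝ (insert u (Set.range w)) =
      (fun x => u + x) '' (Matrix.toLin' (zpM d u w) '' zpDelta d 1) := by
  apply Set.Subset.antisymm
  · apply convexHull_min
    · intro y hy
      rcases hy with rfl | ⟨j, rfl⟩
      · refine ⟨0, ⟨0, ⟨fun i => le_rfl, by simp⟩, by simp⟩, by simp⟩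
      · refine ⟨w j - u, ⟨Pi.single j 1, ⟨fun i => ?_, by simp⟩, ?_⟩, by simp⟩
        · by_cases h : i = j
          · subst h; simp
          · simp [h]
        · ext r
          simp [zpM]
    · have := ((zpDelta_convex d 1).linear_image (Matrix.toLin' (zpM d u w))).translate u
      exact this
  · rintro _ ⟨_, ⟨x, hx, rfl⟩, rfl⟩
    have hconv := convex_convexHull ℝ (insert u (Set.range w))
    have h := hconv.sum_mem (t := Finset.univ) (w := Fin.cons (1 - ∑ i, x i) x)
      (z := (Fin.cons u w : Fin (d + 1) → (Fin d → ℝ))) (by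
        intro i _
        refine Fin.cases ?_ (fun j => ?_) i
        · simp only [Fin.cons_zero]; linarith [hx.2]
        · simpa using hx.1 j) (by simp [Fin.sum_univ_succ]) (by
        intro i _
        apply subset_convexHull
        refine Fin.cases ?_ (fun j => ?_) i
        · simp
        · simp)
    convert h using 1
    ext r
    simp only [Matrix.toLin'_apply, Pi.add_apply, zpM_mulVec, Fin.sum_univ_succ, Fin.cons_zero,
      Fin.cons_succ, Finset.sum_apply, Pi.smul_apply, smul_eq_mul]
    ring

lemma zp_vol (d : ℕ) (u : Fin d → ℝ) (w : Fin d → Fin d → ℝ) :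
    volume (convexHull ℝ (insert u (Set.range w))) =
      ENNReal.ofReal (|(zpM d u w).det| / d.factorial) := by
  rw [zp_hull]
  rw [Set.image_add_left, measure_preimage_add, Measure.addHaar_image_linearMap,
    zpDelta_vol d 1 zero_le_one, LinearMap.det_toLin', ← ENNReal.ofReal_mul (abs_nonneg _)]
  congr 1
  rw [one_pow, mul_one_div]

lemma zp_interior (d : ℕ) (u : Fin d → ℝ) (w : Fin d → Fin d → ℝ) (hdet : (zpM d u w).det ≠ 0)
    (a : Fin d → ℝ) (ha : ∀ j, 0 < a j) (hs : ∑ j, a j < 1) :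
    u + (zpM d u w).mulVec a ∈ interior (convexHull ℝ (insert u (Set.range w))) := by
  have hunit : IsUnit (zpM d u w).det := isUnit_iff_ne_zero.2 hdet
  have hcont : Continuous (fun y : Fin d → ℝ => (zpM d u w)⁻¹.mulVec (y - u)) :=
    (Matrix.mulVecLin (zpM d u w)⁻¹).continuous_of_finiteDimensional.comp
      (continuous_id.sub continuous_const)
  let U : Set (Fin d → ℝ) := {x | (∀ j, 0 < x j) ∧ ∑ j, x j < 1}
  have hU : IsOpen U := by
    have h1 : IsOpen {x : Fin d → ℝ | ∀ i, 0 < x i} := by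
      simp only [Set.ofPred_forall]
      exact isOpen_iInter_of_finite fun i => isOpen_lt continuous_const (continuous_apply i)
    exact h1.inter (isOpen_lt (continuous_finsetSum _ fun i _ => continuous_apply i)
      continuous_const)
  refine mem_interior.2 ⟨_, ?_, hU.preimage hcont, ?_⟩
  · intro y hy
    rw [zp_hull]
    refine ⟨y - u, ⟨_, ⟨fun j => (hy.1 j).le, hy.2.le⟩, ?_⟩, by simp⟩
    rw [Matrix.toLin'_apply, Matrix.mulVec_mulVec, Matrix.mul_nonsing_inv _ hunit,
      Matrix.one_mulVec]
  · simp only [Set.mem_preimage, add_sub_cancel_left]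
    rw [Matrix.mulVec_mulVec, Matrix.nonsing_inv_mul _ hunit, Matrix.one_mulVec]
    exact ⟨ha, hs⟩

lemma zp_coord (d : ℕ) (u : Fin d → ℝ) (w : Fin d → Fin d → ℝ) (hdet : (zpM d u w).det ≠ 0)
    (a : Fin d → ℝ) (hs : ∑ j, a j = 1) :
    (zpM d u w)⁻¹.mulVec ((∑ j, a j • w j) - u) = a := by
  have hunit : IsUnit (zpM d u w).det := isUnit_iff_ne_zero.2 hdet
  have : (∑ j, a j • w j) - u = (zpM d u w).mulVec a := by
    ext r
    rw [zpM_mulVec, hs]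
    simp
  rw [this, Matrix.mulVec_mulVec, Matrix.nonsing_inv_mul _ hunit, Matrix.one_mulVec]

lemma zp_span (d : ℕ) (w : Fin d → Fin d → ℝ)
    (x : Fin d → ℝ) (hx : x ∈ affineSpan ℝ (Set.range w)) :
    ∃ a : Fin d → ℝ, ∑ j, a j = 1 ∧ x = ∑ j, a j • w j := by
  obtain ⟨a, ha, hxa⟩ := eq_affineCombination_of_mem_affineSpan_of_fintype hx
  refine ⟨a, ha, ?_⟩
  rw [hxa, Finset.affineCombination_eq_linear_combination _ _ _ ha]

lemma zp_hull_range (d : ℕ) (w : Fin d → Fin d → ℝ) (x : Fin d → ℝ) :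
    x ∈ convexHull ℝ (Set.range w) ↔
    ∃ a : Fin d → ℝ, (∀ j, 0 ≤ a j) ∧ ∑ j, a j = 1 ∧ x = ∑ j, a j • w j := by
  constructor
  · rw [convexHull_range_eq_exists_affineCombination]
    rintro ⟨s, a, h0, h1, rfl⟩
    classical
    refine ⟨fun j => if j ∈ s then a j else 0, fun j => ?_, ?_, ?_⟩
    · dsimp only
      split_ifs with h
      · exact h0 j h
      · exact le_rfl
    · simpa using h1
    · rw [Finset.affineCombination_eq_linear_combination _ _ _ h1]
      simp [ite_smul]
  · rintro ⟨a, h0, h1, rfl⟩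
    exact (convex_convexHull ℝ _).sum_mem (fun j _ => h0 j) h1
      (fun j _ => subset_convexHull ℝ _ ⟨j, rfl⟩)

lemma zp_intr_mem (d : ℕ) (u : Fin d → ℝ) (w : Fin d → Fin d → ℝ) (hdet : (zpM d u w).det ≠ 0)
    (a : Fin d → ℝ) (ha : ∀ j, 0 < a j) (hs : ∑ j, a j = 1) :
    ∑ j, a j • w j ∈ intrinsicInterior ℝ (convexHull ℝ (Set.range w)) := by
  have hcont : Continuous (fun y : Fin d → ℝ => (zpM d u w)⁻¹.mulVec (y - u)) :=
    (Matrix.mulVecLin (zpM d u w)⁻¹).continuous_of_finiteDimensional.comp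
      (continuous_id.sub continuous_const)
  have hU : IsOpen {x : Fin d → ℝ | ∀ i, 0 < x i} := by
    simp only [Set.ofPred_forall]
    exact isOpen_iInter_of_finite fun i => isOpen_lt continuous_const (continuous_apply i)
  have hmem : ∑ j, a j • w j ∈ convexHull ℝ (Set.range w) :=
    (zp_hull_range d w _).2 ⟨a, fun j => (ha j).le, hs, rfl⟩
  rw [mem_intrinsicInterior]
  refine ⟨⟨∑ j, a j • w j, subset_affineSpan ℝ _ hmem⟩, ?_, rfl⟩
  refine mem_interior.2 ⟨_, ?_, (hU.preimage hcont).preimage continuous_subtype_val, ?_⟩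
  · rintro ⟨y, hy⟩ hy2
    rw [affineSpan_convexHull] at hy
    obtain ⟨b, hb, rfl⟩ := zp_span d w y hy
    simp only [Set.mem_preimage] at hy2
    rw [zp_coord d u w hdet b hb] at hy2
    exact (zp_hull_range d w _).2 ⟨b, fun j => (hy2 j).le, hb, rfl⟩
  · simp only [Set.mem_preimage]
    rw [zp_coord d u w hdet a hs]
    exact ha

lemma zp_intr_pos (d : ℕ) (u : Fin d → ℝ) (w : Fin d → Fin d → ℝ) (hdet : (zpM d u w).det ≠ 0)
    (p : Fin d → ℝ) (hp : p ∈ intrinsicInterior ℝ (convexHull ℝ (Set.range w))) :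
    ∃ c : Fin d → ℝ, (∀ j, 0 < c j) ∧ ∑ j, c j = 1 ∧ p = ∑ j, c j • w j := by
  classical
  obtain ⟨c, hc0, hc1, hpc⟩ := (zp_hull_range d w p).1 (intrinsicInterior_subset hp)
  refine ⟨c, fun l => lt_of_le_of_ne (hc0 l) fun h0 => ?_, hc1, hpc⟩
  obtain ⟨y, hy, rfl⟩ := mem_intrinsicInterior.1 hp
  rw [mem_interior_iff_mem_nhds] at hy
  have hwl : w l ∈ affineSpan ℝ (convexHull ℝ (Set.range w)) :=
    subset_affineSpan ℝ _ (subset_convexHull ℝ _ ⟨l, rfl⟩)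
  let f : ℝ → affineSpan ℝ (convexHull ℝ (Set.range w)) := fun τ =>
    ⟨AffineMap.lineMap (w l) (y : Fin d → ℝ) (1 + τ), AffineMap.lineMap_mem _ hwl y.2⟩
  have hf : Continuous f := by
    apply Continuous.subtype_mk
    exact AffineMap.lineMap_continuous.comp (by fun_prop)
  have hf0 : f 0 = y := by
    apply Subtype.ext; simp [f]
  rw [← hf0] at hy
  have hev := hf.continuousAt.preimage_mem_nhds hy
  obtain ⟨ε, hε, hball⟩ := Metric.mem_nhds_iff.1 hev
  have hτ : ε / 2 ∈ Metric.ball (0 : ℝ) ε := by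
    rw [Metric.mem_ball, dist_zero_right, Real.norm_eq_abs, abs_of_pos (by linarith)]; linarith
  have hmem := hball hτ
  simp only [Set.mem_preimage, f] at hmem
  obtain ⟨b, hb0, hb1, hb⟩ := (zp_hull_range d w _).1 hmem
  let c' : Fin d → ℝ := fun j => (1 + ε / 2) * c j - (ε / 2) * (if j = l then 1 else 0)
  have hc'1 : ∑ j, c' j = 1 := by
    simp only [c']
    rw [Finset.sum_sub_distrib, ← Finset.mul_sum, ← Finset.mul_sum, hc1]
    simp
  have hc' : AffineMap.lineMap (w l) (y : Fin d → ℝ) (1 + ε / 2) = ∑ j, c' j • w j := by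
    simp only [c', sub_smul, Finset.sum_sub_distrib, mul_smul, ← Finset.smul_sum, ← hpc]
    simp [AffineMap.lineMap_apply_module]
    module
  have hbc : b = c' := by
    rw [← zp_coord d u w hdet b hb1, ← zp_coord d u w hdet c' hc'1, ← hb, ← hc']
  have := hb0 l
  rw [hbc] at this
  simp only [c', ← h0, if_true] at this
  linarith

lemma sylAux_prod (D : ℕ) : ∏ i : Fin D, (sylAux i : ℝ) = (sylAux D : ℝ) - 1 := by
  induction D with
  | zero => simp [sylAux]; norm_num
  | succ D ih =>
    rw [Fin.prod_univ_castSucc, sylAux_succ_real]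
    simp only [Fin.val_castSucc, Fin.val_last]
    rw [ih]; ring

lemma zp_ZPW (D k : ℕ) : volume (ZPW (D + 1) k) =
    ENNReal.ofReal ((1 / ((D + 1).factorial : ℝ)) * ((k : ℝ) + 1) * ((syl (D + 1) : ℝ) - 1) ^ 2) := by
  rw [ZPW, zp_vol]
  congr 1
  have hdiag : zpM (D + 1) 0 (fun i : Fin (D + 1) =>
      (if i.1 = D + 1 - 1 then ((k : ℝ) + 1) * ((syl (D + 1) : ℝ) - 1) else (syl (i.1 + 1) : ℝ)) •
      stdBasis (D + 1) i) = Matrix.diagonal (fun i : Fin (D + 1) =>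
      (if i.1 = D + 1 - 1 then ((k : ℝ) + 1) * ((syl (D + 1) : ℝ) - 1)
        else (syl (i.1 + 1) : ℝ))) := by
    ext r j
    by_cases h : r = j
    · subst h; simp [zpM, stdBasis]
    · simp [zpM, stdBasis, h]
  rw [hdiag, Matrix.det_diagonal, Fin.prod_univ_castSucc]
  have h1 : ∀ i : Fin D, ((if (Fin.castSucc i).1 = D + 1 - 1 then
      ((k : ℝ) + 1) * ((syl (D + 1) : ℝ) - 1) else (syl ((Fin.castSucc i).1 + 1) : ℝ))) =
      (sylAux i : ℝ) := by
    intro i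
    rw [if_neg]
    · simp [syl]
    · have := i.2
      simp only [Fin.val_castSucc]; omega
  rw [Finset.prod_congr rfl fun i _ => h1 i, sylAux_prod]
  simp only [syl, Fin.val_last, Nat.add_sub_cancel, if_true]
  have h2 := zp_cast D
  have h3 : (0 : ℝ) ≤ (sylAux D : ℝ) - 1 := by linarith
  rw [abs_of_nonneg (by positivity)]
  ring

lemma zp_lattice_finite (d : ℕ) (s : Set (Fin d → ℝ)) (hs : Bornology.IsBounded s) :
    (latticePts d ∩ s).Finite := by
  obtain ⟨R, hR⟩ := hs.exists_norm_le
  have hfin : (Set.Icc (fun _ => -⌈R⌉ : Fin d → ℤ) (fun _ => ⌈R⌉)).Finite := Set.finite_Icc _ _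
  refine (hfin.image (fun z : Fin d → ℤ => fun i => (z i : ℝ))).subset ?_
  rintro _ ⟨⟨z, rfl⟩, hz⟩
  refine ⟨z, ?_, rfl⟩
  have h1 : ∀ i, |(z i : ℝ)| ≤ ⌈R⌉ := fun i =>
    ((norm_le_pi_norm (fun i => (z i : ℝ)) i).trans (hR _ hz)).trans (Int.le_ceil R)
  constructor
  · intro i
    have := (abs_le.1 (h1 i)).1
    exact_mod_cast this
  · intro i
    have := (abs_le.1 (h1 i)).2
    exact_mod_cast this

/-- Main result (optimality part): for `d ≥ 2` and `k ≥ 0`, every `d`-dimensional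
lattice simplex `S` with exactly `k` interior lattice points having a facet with exactly
one lattice point in its relative interior satisfies
`vol S ≤ (1/d!)(k+1)(s_d - 1)^2`, and this bound is the volume of `S_{d,k}`. -/
theorem volume_max_in_Sdk1
    (d k : ℕ) (hd : 2 ≤ d)
    (v : Fin (d + 1) → (Fin d → ℝ)) (hv : AffineIndependent ℝ v)
    (hvlat : ∀ i, v i ∈ latticePts d)
    (S : Set (Fin d → ℝ)) (hS : S = convexHull ℝ (Set.range v))
    (hk : (latticePts d ∩ interior S).ncard = k)
    (hfacet : ∃ i0 : Fin (d + 1),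
      (latticePts d ∩ intrinsicInterior ℝ (convexHull ℝ (v '' {i | i ≠ i0}))).ncard = 1) :
    volume S ≤
      ENNReal.ofReal ((1 / (d.factorial : ℝ)) * ((k : ℝ) + 1) * ((syl d : ℝ) - 1) ^ 2) ∧
    volume (ZPW d k) =
      ENNReal.ofReal ((1 / (d.factorial : ℝ)) * ((k : ℝ) + 1) * ((syl d : ℝ) - 1) ^ 2) := by
  obtain ⟨D, rfl⟩ : ∃ D, d = D + 1 := ⟨d - 1, by omega⟩
  refine ⟨?_, zp_ZPW D k⟩
  obtain ⟨i0, hi0⟩ := hfacet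
  choose vz hvz using hvlat
  let u : Fin (D + 1) → ℤ := vz i0
  let w : Fin (D + 1) → Fin (D + 1) → ℤ := fun j => vz (i0.succAbove j)
  let ur : Fin (D + 1) → ℝ := fun r => (u r : ℝ)
  let wr : Fin (D + 1) → Fin (D + 1) → ℝ := fun j r => (w j r : ℝ)
  have hur : v i0 = ur := (hvz i0).symm
  have hwr : ∀ j, v (i0.succAbove j) = wr j := fun j => (hvz _).symm
  have hrange : Set.range v = insert ur (Set.range wr) := by
    ext x
    constructor
    · rintro ⟨i, rfl⟩
      rcases Fin.eq_self_or_eq_succAbove i0 i with rfl | ⟨j, rfl⟩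
      · exact Or.inl hur
      · exact Or.inr ⟨j, (hwr j).symm⟩
    · rintro (rfl | ⟨j, rfl⟩)
      · exact ⟨i0, hur⟩
      · exact ⟨_, hwr j⟩
  have himage : v '' {i | i ≠ i0} = Set.range wr := by
    ext x
    constructor
    · rintro ⟨i, hi, rfl⟩
      rcases Fin.eq_self_or_eq_succAbove i0 i with rfl | ⟨j, rfl⟩
      · exact absurd rfl hi
      · exact ⟨j, (hwr j).symm⟩
    · rintro ⟨j, rfl⟩
      exact ⟨_, Fin.succAbove_ne i0 j, hwr j⟩
  have hdet : (zpM (D + 1) ur wr).det ≠ 0 := by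
    have hli := (affineIndependent_iff_linearIndependent_vsub ℝ v i0).1 hv
    have hli2 := hli.comp (finSuccAboveEquiv i0) (finSuccAboveEquiv i0).injective
    have hcol : LinearIndependent ℝ (zpM (D + 1) ur wr).col := by
      have heq : (zpM (D + 1) ur wr).col =
          ((fun i : {x // x ≠ i0} => v i -ᵥ v i0) ∘ (finSuccAboveEquiv i0)) := by
        ext j r
        simp [zpM, hur, hwr, finSuccAboveEquiv]
      rw [heq]
      exact hli2
    have := Matrix.linearIndependent_cols_iff_isUnit.1 hcol
    exact ((Matrix.isUnit_iff_isUnit_det _).1 this).ne_zero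
  rw [himage] at hi0
  obtain ⟨p0, hp0⟩ := Set.ncard_eq_one.1 hi0
  have hp0mem : p0 ∈ latticePts (D + 1) ∩ intrinsicInterior ℝ (convexHull ℝ (Set.range wr)) := by
    rw [hp0]; exact Set.mem_singleton _
  obtain ⟨⟨p, rfl⟩, hpI⟩ := hp0mem
  obtain ⟨c, hc, hc1, hpc⟩ := zp_intr_pos (D + 1) ur wr hdet _ hpI
  have hp : ∀ r, (p r : ℝ) = ∑ j, c j * w j r := by
    intro r
    have := congrFun hpc r
    simpa [wr] using this
  have huniq : ∀ (q : Fin (D + 1) → ℤ) (a : Fin (D + 1) → ℝ), (∀ j, 0 < a j) → ∑ j, a j = 1 →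
      (∀ r, (q r : ℝ) = ∑ j, a j * w j r) → a = c := by
    intro q a ha ha1 hq
    have hqa : (fun r => (q r : ℝ)) = ∑ j, a j • wr j := by
      ext r; simp [wr, hq r]
    have hmem := zp_intr_mem (D + 1) ur wr hdet a ha ha1
    have h1 : ∑ j, a j • wr j ∈ latticePts (D + 1) ∩
        intrinsicInterior ℝ (convexHull ℝ (Set.range wr)) := ⟨⟨q, hqa⟩, hmem⟩
    rw [hp0, Set.mem_singleton_iff, hpc] at h1
    rw [← zp_coord (D + 1) ur wr hdet a ha1, ← zp_coord (D + 1) ur wr hdet c hc1, h1]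
  have hbd : Bornology.IsBounded (convexHull ℝ (Set.range v)) :=
    isBounded_convexHull.2 (Set.finite_range v).isBounded
  have hfin : (latticePts (D + 1) ∩ interior S).Finite :=
    zp_lattice_finite _ _ (hS ▸ hbd.subset interior_subset)
  have hdb := zp_detbound (D + 1) k u w p c hdet hc hc1 hp huniq (by
    intro Z hZ
    rw [← hk, ← Set.ncard_coe_finset Z,
      ← Set.ncard_image_of_injective (Z : Set (Fin (D + 1) → ℤ))
        (f := fun z : Fin (D + 1) → ℤ => fun i => (z i : ℝ)) (by
          intro z z' h
          ext i
          have : (z i : ℝ) = z' i := congrFun h i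
          exact_mod_cast this)]
    refine Set.ncard_le_ncard ?_ hfin
    rintro _ ⟨z, hz, rfl⟩
    refine ⟨⟨z, rfl⟩, ?_⟩
    obtain ⟨a, ha, ha1, hza⟩ := hZ z hz
    have := zp_interior (D + 1) ur wr hdet a ha ha1
    rw [hS, hrange]
    convert this using 1
    ext r
    exact hza r)
  have hnum := zp_numeric_fin D c hc hc1
    (fun J hJ => zp_prodsum (D + 1) w p c hc hc1 hp huniq J hJ)
  rw [hS, hrange, zp_vol]
  apply ENNReal.ofReal_le_ofReal
  have h2 := zp_cast D
  have h3 : (0 : ℝ) < (sylAux D : ℝ) - 1 := by linarith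
  have h4 : |(zpM (D + 1) ur wr).det| * zpQ D ^ 2 ≤ k + 1 :=
    (mul_le_mul_of_nonneg_left hnum (abs_nonneg _)).trans hdb
  have h5 : |(zpM (D + 1) ur wr).det| ≤ ((k : ℝ) + 1) * ((sylAux D : ℝ) - 1) ^ 2 := by
    have h6 := mul_le_mul_of_nonneg_right h4 (sq_nonneg ((sylAux D : ℝ) - 1))
    have h7 : zpQ D * ((sylAux D : ℝ) - 1) = 1 := by
      unfold zpQ; field_simp
    rwa [mul_assoc, ← mul_pow, h7, one_pow, mul_one] at h6
  simp only [syl, Nat.add_sub_cancel]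
  rw [mul_assoc, one_div_mul_eq_div]
  gcongr
end
end

section
/- Let d ≥ 1 and k ≥ 1 be integers and let S ⊆ ℝ^d be a d-dimensional simplex (not necessarily with integer vertices) whose interior contains exactly k points of ℤ^d. Let x be an interior lattice point of S and let β_1 ≥ β_2 ≥ … ≥ β_{d+1} > 0 be the barycentric coordinates of x with respect to S, ordered descendingly. Then vol(S) ≤ k/(d! · β_1 ⋯ β_d) (the product extending over the d largest barycentric coordinates). -/
open MeasureTheory ENNReal

noncomputable section

def cornerSimplex (n : ℕ) (r : ℝ) : Set (Fin n → ℝ) :=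
  {t | (∀ i, 0 ≤ t i) ∧ ∑ i, t i ≤ r}

theorem cornerSimplex_measurable (n : ℕ) (r : ℝ) : MeasurableSet (cornerSimplex n r) := by
  have h : IsClosed (cornerSimplex n r) := by
    have : cornerSimplex n r = (⋂ i, {t : Fin n → ℝ | 0 ≤ t i}) ∩ {t | ∑ i, t i ≤ r} := by
      ext t; simp [cornerSimplex]
    rw [this]
    refine IsClosed.inter (isClosed_iInter fun i => isClosed_le (by fun_prop) (by fun_prop))
      (isClosed_le (by fun_prop) (by fun_prop))
  exact h.measurableSet

theorem volume_cornerSimplex_le (n : ℕ) : ∀ r : ℝ, 0 ≤ r →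
    volume (cornerSimplex n r) ≤ ENNReal.ofReal (r ^ n / (n.factorial : ℝ)) := by
  induction n with
  | zero =>
    intro r hr
    refine (measure_mono (Set.subset_univ _)).trans ?_
    rw [volume_pi, Measure.pi_univ]
    simp
  | succ n ih =>
    intro r hr
    have hmp := (volume_preserving_piFinSuccAbove (fun _ : Fin (n + 1) => ℝ) 0).symm
    rw [← hmp.measure_preimage (cornerSimplex_measurable _ _).nullMeasurableSet,
      Measure.volume_eq_prod,
      Measure.prod_apply (hmp.measurable (cornerSimplex_measurable _ _))]
    have hle : ∀ a : ℝ, volume (Prod.mk a ⁻¹'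
        ((MeasurableEquiv.piFinSuccAbove (fun _ : Fin (n + 1) => ℝ) 0).symm ⁻¹'
          cornerSimplex (n + 1) r)) ≤
        (Set.Icc 0 r).indicator
          (fun a => ENNReal.ofReal ((r - a) ^ n / (n.factorial : ℝ))) a := by
      intro a
      by_cases ha : a ∈ Set.Icc 0 r
      · rw [Set.indicator_of_mem ha]
        refine (measure_mono ?_).trans (ih (r - a) (by linarith [ha.2]))
        intro t ht
        simp only [Set.mem_preimage, cornerSimplex, Set.mem_ofPred_eq,
          MeasurableEquiv.piFinSuccAbove_symm_apply, Fin.insertNthEquiv_zero,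
          Fin.consEquiv_apply, Fin.sum_univ_succ, Fin.forall_fin_succ,
          Fin.cons_zero, Fin.cons_succ] at ht ⊢
        exact ⟨ht.1.2, by linarith [ht.2]⟩
      · rw [Set.indicator_of_notMem ha]
        refine le_of_eq ?_
        convert measure_empty (μ := (volume : Measure (Fin n → ℝ)))
        ext t
        simp only [Set.mem_preimage, cornerSimplex, Set.mem_ofPred_eq,
          MeasurableEquiv.piFinSuccAbove_symm_apply, Fin.insertNthEquiv_zero,
          Fin.consEquiv_apply, Fin.sum_univ_succ, Fin.forall_fin_succ,
          Fin.cons_zero, Fin.cons_succ, Set.mem_empty_iff_false, iff_false]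
        rintro ⟨⟨h0, h1⟩, h2⟩
        exact ha ⟨h0, by linarith [Finset.sum_nonneg (s := Finset.univ) (fun i _ => h1 i)]⟩
    refine (lintegral_mono hle).trans ?_
    rw [lintegral_indicator measurableSet_Icc, ← ofReal_integral_eq_lintegral_ofReal]
    · refine ENNReal.ofReal_le_ofReal (le_of_eq ?_)
      rw [integral_Icc_eq_integral_Ioc, ← intervalIntegral.integral_of_le hr]
      rw [intervalIntegral.integral_div,
        intervalIntegral.integral_comp_sub_left (fun a => a ^ n) r, integral_pow]
      simp [Nat.factorial_succ]
      field_simp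
    · exact (Continuous.integrableOn_Icc (by fun_prop))
    · refine (ae_restrict_iff' measurableSet_Icc).2 (Filter.Eventually.of_forall fun a ha => ?_)
      have : 0 ≤ r - a := by linarith [ha.2]
      simp only [Pi.zero_apply]
      positivity

theorem mem_lattice_span (d : ℕ) (g : Fin d → ℝ) :
    g ∈ Submodule.span ℤ (Set.range (Pi.basisFun ℝ (Fin d))) ↔ g ∈ latticePts d := by
  rw [Module.Basis.mem_span_iff_repr_mem]
  simp only [Pi.basisFun_repr, latticePts, Set.mem_range]
  constructor
  · intro h
    choose z hz using h
    exact ⟨z, by ext i; simpa using hz i⟩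
  · rintro ⟨z, rfl⟩ i
    exact ⟨z i, by simp⟩

/-- Blichfeldt -/
theorem blichfeldt (d k : ℕ) (Q : Set (Fin d → ℝ)) (hQ : MeasurableSet Q)
    (h : ∀ (y : Fin d → ℝ) (F : Finset (Fin d → ℝ)),
      (∀ g ∈ F, g ∈ latticePts d ∧ g + y ∈ Q) → F.card ≤ k) :
    volume Q ≤ k := by
  classical
  let b := Pi.basisFun ℝ (Fin d)
  have hF := ZSpan.isAddFundamentalDomain' b (volume : Measure (Fin d → ℝ))
  have hcount : Countable ((Submodule.span ℤ (Set.range b)).toAddSubgroup) := by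
    change Countable (Submodule.span ℤ (Set.range b))
    infer_instance
  have hvol : volume (ZSpan.fundamentalDomain b) = 1 := by
    rw [ZSpan.volume_fundamentalDomain]
    have : Matrix.of (b : Fin d → Fin d → ℝ) = 1 := by
      ext i j; simp [b, Matrix.one_apply, Pi.single_apply, eq_comm]
    rw [this]; simp
  rw [← lintegral_indicator_one hQ, hF.lintegral_eq_tsum'', ← lintegral_tsum]
  · calc _ ≤ ∫⁻ y in ZSpan.fundamentalDomain b, (k : ℝ≥0∞) := by
          refine lintegral_mono fun y => ?_
          rw [ENNReal.tsum_eq_iSup_sum]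
          refine iSup_le fun F => ?_
          have hcard := h y ((F.filter (fun g => g +ᵥ y ∈ Q)).map
            ⟨Subtype.val, Subtype.val_injective⟩) (by
              intro g hg
              simp only [Finset.mem_map, Finset.mem_filter, Function.Embedding.coeFn_mk] at hg
              obtain ⟨g', ⟨-, hg'⟩, rfl⟩ := hg
              exact ⟨(mem_lattice_span d _).1 g'.2, hg'⟩)
          rw [Finset.card_map] at hcard
          have : ∑ g ∈ F, Q.indicator (1 : (Fin d → ℝ) → ℝ≥0∞) (g +ᵥ y) =
              ((F.filter (fun g => g +ᵥ y ∈ Q)).card : ℝ≥0∞) := by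
            rw [Finset.card_filter]
            push_cast
            refine Finset.sum_congr rfl fun g _ => ?_
            simp [Set.indicator_apply]
          rw [this]
          exact_mod_cast hcard
      _ = k := by simp [hvol]
  · intro g
    exact ((measurable_one.indicator hQ).comp (measurable_const_vadd g)).aemeasurable

def edgeMap (d : ℕ) (v : Fin (d + 1) → (Fin d → ℝ)) : (Fin d → ℝ) →ₗ[ℝ] (Fin d → ℝ) :=
  Fintype.linearCombination ℝ (fun i : Fin d => v i.castSucc - v (Fin.last d))

theorem edgeMap_apply (d : ℕ) (v : Fin (d + 1) → (Fin d → ℝ)) (t : Fin d → ℝ) :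
    edgeMap d v t = ∑ i : Fin d, t i • v i.castSucc - (∑ i, t i) • v (Fin.last d) := by
  simp [edgeMap, Fintype.linearCombination_apply, smul_sub, Finset.sum_sub_distrib,
    Finset.sum_smul]

theorem volume_simplex_le (d : ℕ) (v : Fin (d + 1) → (Fin d → ℝ)) :
    volume (convexHull ℝ (Set.range v)) ≤
      ENNReal.ofReal |LinearMap.det (edgeMap d v)| * ENNReal.ofReal (1 / (d.factorial : ℝ)) := by
  have hsub : convexHull ℝ (Set.range v) ⊆
      (fun y => v (Fin.last d) + y) '' (edgeMap d v '' cornerSimplex d 1) := by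
    intro y hy
    rw [convexHull_range_eq_exists_affineCombination] at hy
    obtain ⟨s, w, hw0, hw1, rfl⟩ := hy
    let u : Fin (d + 1) → ℝ := fun i => if i ∈ s then w i else 0
    have hu0 : ∀ i, 0 ≤ u i := by
      intro i
      by_cases hi : i ∈ s <;> simp [u, hi, hw0]
    have hu1 : ∑ i, u i = 1 := by simpa [u] using hw1
    have hy : s.affineCombination ℝ v w = ∑ i, u i • v i := by
      rw [s.affineCombination_eq_linear_combination _ _ hw1]
      simp [u, ite_smul]
    rw [Fin.sum_univ_castSucc] at hu1
    refine ⟨_, ⟨fun i => u i.castSucc, ⟨fun i => hu0 _, ?_⟩, rfl⟩, ?_⟩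
    · linarith [hu0 (Fin.last d)]
    · rw [hy, Fin.sum_univ_castSucc]
      simp only [edgeMap_apply]
      have : u (Fin.last d) = 1 - ∑ i : Fin d, u i.castSucc := by linarith
      rw [this]
      module
  refine (measure_mono hsub).trans ?_
  rw [Set.image_add_left, measure_preimage_add, Measure.addHaar_image_linearMap]
  gcongr
  simpa using volume_cornerSimplex_le d 1 zero_le_one

/-- Pikhurko's bound: if a `d`-dimensional simplex `S` (not necessarily a lattice simplex)
has exactly `k ≥ 1` interior lattice points and `x` is an interior lattice point of `S` with
barycentric coordinates `β_1 ≥ … ≥ β_{d+1} > 0` (ordered descendingly), then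
`vol S ≤ k / (d! β_1 ⋯ β_d)`, the product extending over the `d` largest coordinates. -/
theorem pikhurko_volume_bound
    (d k : ℕ) (hd : 1 ≤ d) (hk1 : 1 ≤ k)
    (v : Fin (d + 1) → (Fin d → ℝ)) (hv : AffineIndependent ℝ v)
    (S : Set (Fin d → ℝ)) (hS : S = convexHull ℝ (Set.range v))
    (hk : (latticePts d ∩ interior S).ncard = k)
    (x : Fin d → ℝ) (hx : x ∈ latticePts d ∩ interior S)
    (β : Fin (d + 1) → ℝ)
    (hβpos : ∀ i, 0 < β i)
    (hβsorted : Antitone β)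
    (hβsum : ∑ i, β i = 1)
    (hβx : x = ∑ i, β i • v i) :
    volume S ≤
      ENNReal.ofReal ((k : ℝ) /
        ((d.factorial : ℝ) * ∏ i : Fin d, β i.castSucc)) := by
  classical
  set L := edgeMap d v with hL
  have hprod : 0 < ∏ i : Fin d, β i.castSucc := Finset.prod_pos fun i _ => hβpos _
  have hSle := volume_simplex_le d v
  rw [← hS, ← hL] at hSle
  by_cases hdet : LinearMap.det L = 0
  · rw [hdet] at hSle
    simp only [abs_zero, ENNReal.ofReal_zero, zero_mul] at hSle
    exact hSle.trans zero_le
  let box : Set (Fin d → ℝ) := Set.univ.pi fun i : Fin d => Set.Ioo 0 (β i.castSucc)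
  have hQm : MeasurableSet (L '' box) := by
    have hbij : Function.Surjective L := (L.equivOfDetNeZero hdet).surjective
    refine (L.isOpenMap_of_finiteDimensional hbij _ ?_).measurableSet
    exact isOpen_set_pi Set.finite_univ fun i _ => isOpen_Ioo
  have hQv : volume (L '' box) =
      ENNReal.ofReal (|LinearMap.det L| * ∏ i : Fin d, β i.castSucc) := by
    rw [Measure.addHaar_image_linearMap, ENNReal.ofReal_mul (abs_nonneg _), volume_pi_pi,
      ENNReal.ofReal_prod_of_nonneg (fun i _ => (hβpos _).le)]
    simp
  -- interior points
  have hint : ∀ t : Fin d → ℝ, (∀ i, -β i.castSucc < t i) → ∑ i, t i ≤ 0 →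
      x + L t ∈ interior S := by
    intro t ht hts
    let B : AffineBasis (Fin (d + 1)) ℝ (Fin d → ℝ) :=
      ⟨v, hv, by rw [hv.affineSpan_eq_top_iff_card_eq_finrank_add_one]; simp⟩
    have hSB : S = convexHull ℝ (Set.range B) := hS
    rw [hSB, B.interior_convexHull]
    let w : Fin (d + 1) → ℝ := Fin.snoc (fun i : Fin d => β i.castSucc + t i)
      (β (Fin.last d) - ∑ i, t i)
    have hw1 : ∑ i, w i = 1 := by
      rw [Fin.sum_univ_castSucc] at hβsum ⊢
      simp only [w, Fin.snoc_castSucc, Fin.snoc_last, Finset.sum_add_distrib]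
      linarith
    have hxw : x + L t = Finset.univ.affineCombination ℝ B w := by
      rw [Finset.univ.affineCombination_eq_linear_combination _ _ hw1, hβx, hL, edgeMap_apply]
      change _ = ∑ i, w i • v i
      rw [Fin.sum_univ_castSucc, Fin.sum_univ_castSucc]
      simp only [w, Fin.snoc_castSucc, Fin.snoc_last, add_smul, Finset.sum_add_distrib]
      module
    intro i
    rw [hxw, B.coord_apply_combination_of_mem (Finset.mem_univ i) hw1]
    refine Fin.lastCases ?_ (fun j => ?_) i
    · simp only [w, Fin.snoc_last]
      linarith [hβpos (Fin.last d)]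
    · simp only [w, Fin.snoc_castSucc]
      linarith [ht j]
  have hfin : (latticePts d ∩ interior S).Finite :=
    Set.finite_of_ncard_ne_zero (by omega)
  have hB : volume (L '' box) ≤ k := by
    refine blichfeldt d k _ hQm ?_
    intro y F hF
    rcases F.eq_empty_or_nonempty with rfl | hne
    · simp
    have hch : ∀ g : Fin d → ℝ, ∃ t : Fin d → ℝ, g ∈ F → t ∈ box ∧ L t = g + y := by
      intro g
      by_cases hg : g ∈ F
      · obtain ⟨t, ht, hty⟩ := (hF g hg).2
        exact ⟨t, fun _ => ⟨ht, hty⟩⟩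
      · exact ⟨0, fun h => absurd h hg⟩
    choose T hT using hch
    obtain ⟨m, hm, hmax⟩ := F.exists_max_image (fun g => ∑ i, T g i) hne
    rw [← hk, ← Set.ncard_coe_finset]
    refine Set.ncard_le_ncard_of_injOn (fun g => x + (g - m)) ?_ ?_ hfin
    · intro g hg
      have hg : g ∈ F := hg
      refine ⟨?_, ?_⟩
      · rw [← mem_lattice_span]
        exact add_mem ((mem_lattice_span d _).2 hx.1)
          (sub_mem ((mem_lattice_span d _).2 (hF g hg).1) ((mem_lattice_span d _).2 (hF m hm).1))
      · have : g - m = L (T g - T m) := by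
          rw [map_sub, (hT g hg).2, (hT m hm).2]; abel
        change x + (g - m) ∈ _
        rw [this]
        refine hint _ (fun i => ?_) ?_
        · have h1 := ((hT g hg).1 i trivial).1
          have h2 := ((hT m hm).1 i trivial).2
          simp only [Pi.sub_apply]
          linarith
        · simp only [Pi.sub_apply, Finset.sum_sub_distrib]
          linarith [hmax g hg]
    · intro a _ b _ hab
      simpa using hab
  rw [hQv, ENNReal.ofReal_le_natCast] at hB
  refine hSle.trans ?_
  rw [← ENNReal.ofReal_mul (abs_nonneg _)]
  refine ENNReal.ofReal_le_ofReal ?_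
  have hf : (0 : ℝ) < d.factorial := by positivity
  rw [le_div_iff₀ (by positivity)]
  calc _ = |LinearMap.det L| * ∏ i : Fin d, β i.castSucc := by field_simp
    _ ≤ k := hB
end
end

section
/- Let Λ be a lattice of rank d in ℝ^d and let C ⊆ ℝ^d be a compact convex set with nonempty interior that is symmetric about the origin (x ∈ C implies −x ∈ C). Then vol(C) ≤ (|Λ ∩ int(C)| + 1) · 2^{d−1} · det(Λ). -/
open MeasureTheory ENNReal

noncomputable section

/-- The lattice `M ℤ^d` of rank `d` determined by a nonsingular matrix `M`;
its determinant is `|det M|`. -/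
def matLattice {d : ℕ} (M : Matrix (Fin d) (Fin d) ℝ) : Set (Fin d → ℝ) :=
  Set.range fun z : Fin d → ℤ => M.mulVec fun i => (z i : ℝ)

open scoped Pointwise

theorem vdc_count {E : Type*} [AddCommGroup E] [Module ℝ E] [IsAddTorsionFree E]
    (L : AddSubgroup E) (K : Set E) (hK : Convex ℝ K) (hs : ∀ x ∈ K, -x ∈ K)
    (hfin : ((L : Set E) ∩ K).Finite) (x : E) (T : Finset L)
    (hT : ∀ g ∈ T, x ∈ g +ᵥ ((2⁻¹ : ℝ) • K)) :
    2 * T.card ≤ ((L : Set E) ∩ K).ncard + 1 := by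
  classical
  rcases T.eq_empty_or_nonempty with rfl | hne
  · simp
  set A : Finset E := T.image (fun g : L => (g : E)) with hA
  set B : Finset E := T.image (fun g : L => -(g : E)) with hB
  have cA : A.card = T.card := by
    rw [hA]; exact Finset.card_image_of_injective _ Subtype.val_injective
  have cB : B.card = T.card := by
    rw [hB]; exact Finset.card_image_of_injective _ (neg_injective.comp Subtype.val_injective)
  have h := cauchy_davenport_of_isAddTorsionFree (s := A) (t := B) (by rw [hA]; exact hne.image _)
    (by rw [hB]; exact hne.image _)
  have hsub : ((A + B : Finset E) : Set E) ⊆ (L : Set E) ∩ K := by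
    intro y hy
    obtain ⟨a, ha, c, hc, rfl⟩ := Finset.mem_add.1 (Finset.mem_coe.1 hy)
    obtain ⟨g, hg, rfl⟩ := Finset.mem_image.1 ha
    obtain ⟨g', hg', rfl⟩ := Finset.mem_image.1 hc
    refine ⟨L.add_mem g.2 (L.neg_mem g'.2), ?_⟩
    obtain ⟨_, ⟨k, hk, rfl⟩, h1⟩ := hT g hg
    obtain ⟨_, ⟨k', hk', rfl⟩, h2⟩ := hT g' hg'
    have h1' : (g : E) + (2⁻¹ : ℝ) • k = x := h1
    have h2' : (g' : E) + (2⁻¹ : ℝ) • k' = x := h2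
    have := hK hk' (hs k hk) (a := 2⁻¹) (b := 2⁻¹) (by norm_num) (by norm_num) (by norm_num)
    convert this using 1
    rw [eq_sub_of_add_eq h1', eq_sub_of_add_eq h2', smul_neg]
    abel
  have h3 := Set.ncard_le_ncard hsub hfin
  rw [Set.ncard_coe_finset] at h3
  omega

/-- Van der Corput's inequality: for a lattice `Λ = Mℤ^d` of rank `d` in `ℝ^d` and an
`o`-symmetric compact convex set `C ⊆ ℝ^d` with nonempty interior,
`vol C ≤ (|Λ ∩ int C| + 1) · 2^{d-1} · det Λ`. -/
theorem van_der_corput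
    (d : ℕ) (M : Matrix (Fin d) (Fin d) ℝ) (hM : M.det ≠ 0)
    (C : Set (Fin d → ℝ)) (hCcompact : IsCompact C) (hCconv : Convex ℝ C)
    (hCint : (interior C).Nonempty) (hCsym : ∀ x ∈ C, -x ∈ C) :
    volume C ≤
      ENNReal.ofReal ((((matLattice M ∩ interior C).ncard : ℝ) + 1) *
        2 ^ (d - 1) * |M.det|) := by
  classical
  let b : Module.Basis (Fin d) ℝ (Fin d → ℝ) := (Pi.basisFun ℝ (Fin d)).map
    (Matrix.toLinearEquiv' M (M.invertibleOfIsUnitDet (isUnit_iff_ne_zero.2 hM)))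
  have hb : ∀ i, b i = M.col i := by
    intro i
    simp [b, Matrix.toLinearEquiv']
  have hdet : (Matrix.of b).det = M.det := by
    rw [← Matrix.det_transpose]
    congr 1
    ext i j
    simp [hb]
  set L : AddSubgroup (Fin d → ℝ) := (Submodule.span ℤ (Set.range b)).toAddSubgroup with hL
  have hLM : matLattice M = (L : Set (Fin d → ℝ)) := by
    ext y
    change _ ↔ y ∈ Submodule.span ℤ (Set.range b)
    rw [Submodule.mem_span_range_iff_exists_fun]
    refine exists_congr fun z => ?_
    have : ∑ i, z i • b i = M.mulVec fun i => (z i : ℝ) := by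
      ext j
      simp [hb, Matrix.mulVec, dotProduct, mul_comm]
    rw [this]
  set K := interior C with hKdef
  have hK : Convex ℝ K := hCconv.interior
  have hKs : ∀ x ∈ K, -x ∈ K := by
    intro x hx
    have h1 : -C = C := by
      ext y
      exact ⟨fun h => by simpa using hCsym _ h, fun h => hCsym _ h⟩
    have h2 : -K = K := by
      have := (Homeomorph.neg (Fin d → ℝ)).preimage_interior C
      change -K = interior (-C) at this
      rw [this, h1]
    rw [← h2]
    simpa using hx
  have hfin : ((L : Set (Fin d → ℝ)) ∩ K).Finite := by
    rw [Set.inter_comm]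
    exact ZSpan.setFinite_inter b (hCcompact.isBounded.subset interior_subset)
  have hvol : volume C = volume K := by
    refine le_antisymm ?_ (measure_mono interior_subset)
    calc volume C ≤ volume (K ∪ frontier C) := measure_mono (by
          rw [hKdef, ← closure_eq_interior_union_frontier]; exact subset_closure)
      _ ≤ volume K + volume (frontier C) := measure_union_le _ _
      _ = volume K := by rw [hCconv.addHaar_frontier volume, add_zero]
  rw [hLM, hvol]
  set N := ((L : Set (Fin d → ℝ)) ∩ K).ncard with hN
  set S : Set (Fin d → ℝ) := (2⁻¹ : ℝ) • K with hS
  have hSm : MeasurableSet S := (isOpen_interior.smul₀ (by norm_num)).measurableSet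
  have hKS : volume K = ENNReal.ofReal (2 ^ d) * volume S := by
    have : K = (2 : ℝ) • S := by rw [hS, smul_smul]; norm_num
    rw [this, Measure.addHaar_smul]
    simp
  have fund := ZSpan.isAddFundamentalDomain' b (volume : Measure (Fin d → ℝ))
  have hF : volume (ZSpan.fundamentalDomain b) = ENNReal.ofReal |M.det| := by
    rw [ZSpan.volume_fundamentalDomain, hdet]
  have : Countable L := inferInstanceAs (Countable (Submodule.span ℤ (Set.range b)))
  have hmain : volume S ≤ ENNReal.ofReal (((N : ℝ) + 1) / 2) * ENNReal.ofReal |M.det| := by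
    rw [fund.measure_eq_tsum S, ← hF, ← setLIntegral_const]
    have hm : ∀ g : L, MeasurableSet (g +ᵥ S) := fun g => hSm.const_vadd g
    calc ∑' g : L, volume ((g +ᵥ S) ∩ ZSpan.fundamentalDomain b)
        = ∑' g : L, ∫⁻ x in ZSpan.fundamentalDomain b, (g +ᵥ S).indicator 1 x := by
          congr 1
          ext g
          rw [lintegral_indicator_one (hm g), Measure.restrict_apply (hm g)]
      _ = ∫⁻ x in ZSpan.fundamentalDomain b, ∑' g : L, (g +ᵥ S).indicator 1 x := by
          rw [lintegral_tsum]
          exact fun g => (measurable_one.indicator (hm g)).aemeasurable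
      _ ≤ _ := by
          refine lintegral_mono fun x => ?_
          rw [ENNReal.tsum_eq_iSup_sum]
          refine iSup_le fun T => ?_
          have hc := vdc_count L K hK hKs hfin x (T.filter fun g => x ∈ g +ᵥ S)
            (fun g hg => (Finset.mem_filter.1 hg).2)
          have he : ∑ g ∈ T, (g +ᵥ S).indicator (1 : (Fin d → ℝ) → ℝ≥0∞) x
              = ((T.filter fun g => x ∈ g +ᵥ S).card : ℝ≥0∞) := by
            simp [Set.indicator_apply, Finset.sum_boole]
          rw [he, ← ENNReal.ofReal_natCast]
          apply ENNReal.ofReal_le_ofReal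
          have hc' : (2 : ℝ) * ((T.filter fun g => x ∈ g +ᵥ S).card : ℝ) ≤ (N : ℝ) + 1 := by
            exact_mod_cast hc
          linarith
  rw [hKS]
  refine (mul_le_mul_right hmain _).trans ?_
  rw [← ENNReal.ofReal_mul (by positivity), ← ENNReal.ofReal_mul (by positivity)]
  apply ENNReal.ofReal_le_ofReal
  have h2 : (2 : ℝ) ^ d ≤ 2 * 2 ^ (d - 1) := by
    rw [← pow_succ']
    exact pow_le_pow_right₀ (by norm_num) (by omega)
  have h3 : 0 ≤ ((N : ℝ) + 1) / 2 * |M.det| := by positivity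
  calc _ ≤ (2 * 2 ^ (d - 1)) * (((N : ℝ) + 1) / 2 * |M.det|) := mul_le_mul_of_nonneg_right h2 h3
    _ = _ := by ring
end
end
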